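/- arXiv:2411.19694 — 3 statements merged into one kernel-verified Lean document; each statement's English description precedes it below -/
import Mathlib

section
/- Let 0 < β < 1, let 0 < σ₁ < σ₂, and let f : [0,∞) → (0,∞) be a C¹ non-decreasing function such that t ↦ f(t)/t^β is non-decreasing on the interval (σ₁, σ₂). Then there exists σ_* ∈ (0, σ₁] such that f(σ_*)/σ_*^β = inf{ f(t)/t^β : 0 < t ≤ σ₁ }, and there exists a C¹ function h : [0,∞) → (0,∞) such that: h(t) = f(σ_*)/σ_*^β for all 0 ≤ t ≤ σ_*; h(t) = f(t)/t^β for all t ≥ σ₁; h is non-decreasing on (0, σ₂); and h(t) ≤ f(t)/t^β for all t > 0. -/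
open Real

open Set Filter Topology

/-- Gluing two `C¹` functions at a point where values and derivatives agree. -/
lemma contDiff_one_ite_le {A A' B B' : ℝ → ℝ} {c : ℝ}
    (hA : ∀ t ≤ c, HasDerivAt A (A' t) t) (hA' : ContinuousOn A' (Iic c))
    (hB : ∀ t, c ≤ t → HasDerivAt B (B' t) t) (hB' : ContinuousOn B' (Ici c))
    (h₀ : A c = B c) (h₁ : A' c = B' c) :
    ContDiff ℝ 1 (fun t => if t ≤ c then A t else B t) := by
  have hd : ∀ t, HasDerivAt (fun t => if t ≤ c then A t else B t)
      (if t ≤ c then A' t else B' t) t := by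
    intro t
    rcases lt_trichotomy t c with ht | rfl | ht
    · rw [if_pos ht.le]
      refine (hA t ht.le).congr_of_eventuallyEq ?_
      filter_upwards [Iio_mem_nhds ht] with s hs
      rw [if_pos (le_of_lt hs)]
    · rw [if_pos le_rfl, ← hasDerivWithinAt_univ, ← Iic_union_Ici (a := t)]
      refine HasDerivWithinAt.union ?_ ?_
      · exact (hA t le_rfl).hasDerivWithinAt.congr (fun s hs => if_pos hs) (if_pos le_rfl)
      · rw [h₁]
        refine (hB t le_rfl).hasDerivWithinAt.congr (fun s hs => ?_) (by simp [h₀])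
        rcases eq_or_lt_of_le (show t ≤ s from hs) with rfl | hs
        · simp [h₀]
        · rw [if_neg (not_le.2 hs)]
    · rw [if_neg (not_le.2 ht)]
      refine (hB t ht.le).congr_of_eventuallyEq ?_
      filter_upwards [Ioi_mem_nhds ht] with s hs
      rw [if_neg (not_le.2 hs)]
  rw [contDiff_one_iff_deriv]
  refine ⟨fun t => (hd t).differentiableAt, ?_⟩
  rw [show deriv _ = _ from funext fun t => (hd t).deriv]
  have e : (fun t => if t ≤ c then A' t else B' t) =
      fun t => if t ≤ c then A' (min t c) else B' (max t c) := by
    funext t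
    split_ifs with h
    · rw [min_eq_left h]
    · rw [max_eq_left (not_le.1 h).le]
  rw [e]
  refine Continuous.if_le ?_ ?_ continuous_id continuous_const ?_
  · exact hA'.comp_continuous (by fun_prop) fun t => mem_Iic.2 (min_le_right _ _)
  · exact hB'.comp_continuous (by fun_prop) fun t => mem_Ici.2 (le_max_right _ _)
  · rintro t rfl
    simpa using h₁

/-- The square of the positive part is differentiable. -/
lemma hasDerivAt_max_zero_sq (x : ℝ) :
    HasDerivAt (fun x : ℝ => max x 0 ^ 2) (2 * max x 0) x := by
  have hc : ContDiff ℝ 1 (fun t : ℝ => if t ≤ 0 then (0 : ℝ) else t ^ 2) :=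
    contDiff_one_ite_le (A' := fun _ => 0) (B' := fun t => 2 * t)
      (fun t _ => hasDerivAt_const _ _) (by fun_prop)
      (fun t _ => by simpa using hasDerivAt_pow 2 t) (by fun_prop) (by simp) (by simp)
  have e : (fun x : ℝ => max x 0 ^ 2) = fun t : ℝ => if t ≤ 0 then (0 : ℝ) else t ^ 2 := by
    funext t
    split_ifs with h
    · simp [max_eq_right h]
    · rw [max_eq_left (not_le.1 h).le]
  rcases lt_trichotomy x 0 with hx | rfl | hx
  · rw [max_eq_right hx.le, mul_zero]
    refine (hasDerivAt_const x (0 : ℝ)).congr_of_eventuallyEq ?_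
    filter_upwards [Iio_mem_nhds hx] with s hs
    simp [max_eq_right ((mem_Iio.1 hs).le)]
  · have hd : DifferentiableAt ℝ (fun x : ℝ => max x 0 ^ 2) 0 := by
      rw [e]; exact (hc.differentiable one_ne_zero) 0
    have hm : IsLocalMin (fun x : ℝ => max x 0 ^ 2) 0 :=
      Eventually.of_forall fun t => by simp
    simpa [hm.deriv_eq_zero] using hd.hasDerivAt
  · rw [max_eq_left hx.le]
    refine (show HasDerivAt (fun x : ℝ => x ^ 2) (2 * x) x by
      simpa using hasDerivAt_pow 2 x).congr_of_eventuallyEq ?_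
    filter_upwards [Ioi_mem_nhds hx] with s hs
    simp [max_eq_left ((mem_Ioi.1 hs).le)]

/-- If `a < b` and `g` is `C¹` on `[a, b]` with minimum `g a < g b` and `0 ≤ g' b`, there is a
non-decreasing `C¹` function below `g` on `[a, b]` that is constant on `(-∞, a]` and touches `g` to
first order at `b`. -/
lemma exists_monotone_minorant {g g' : ℝ → ℝ} {a b : ℝ} (hab : a < b)
    (hg : ∀ t ∈ Icc a b, HasDerivAt g (g' t) t) (hg' : ContinuousOn g' (Icc a b))
    (hmin : ∀ t ∈ Icc a b, g a ≤ g t) (hlt : g a < g b) (hb : 0 ≤ g' b) :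
    ∃ A A' : ℝ → ℝ, (∀ t ≤ b, HasDerivAt A (A' t) t) ∧ ContinuousOn A' (Iic b) ∧
      A b = g b ∧ A' b = g' b ∧ MonotoneOn A (Iic b) ∧ (∀ t ≤ a, A t = g a) ∧
      ∀ t ∈ Icc a b, A t ≤ g t := by
  set k : ℝ → ℝ := fun t => max (g' (max a (min t b))) 0 with hk
  have hkc : Continuous k := by
    refine Continuous.max (hg'.comp_continuous (by fun_prop) fun t => ?_) continuous_const
    exact ⟨le_max_left _ _, max_le hab.le (min_le_right _ _)⟩
  have hk0 : ∀ t, 0 ≤ k t := fun t => le_max_right _ _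
  have hkg : ∀ t ∈ Icc a b, g' t ≤ k t := fun t ht => by
    simp [hk, min_eq_left ht.2, max_eq_right ht.1]
  have hkb : k b = g' b := by simp [hk, max_eq_right hab.le, hb]
  set u : ℝ → ℝ := fun t => g b + ∫ s in b..t, k s with hu
  have hud : ∀ t, HasDerivAt u (k t) t := fun t =>
    (hkc.integral_hasStrictDerivAt b t).hasDerivAt.const_add _
  have hum : Monotone u := monotone_of_deriv_nonneg (fun t => (hud t).differentiableAt)
    fun t => by rw [(hud t).deriv]; exact hk0 t
  have hub : u b = g b := by simp [hu]
  have hug : ∀ t ∈ Icc a b, u t ≤ g t := by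
    have hmo : MonotoneOn (fun t => u t - g t) (Icc a b) := by
      have hd : ∀ t ∈ Icc a b, HasDerivAt (fun t => u t - g t) (k t - g' t) t :=
        fun t ht => (hud t).sub (hg t ht)
      refine monotoneOn_of_deriv_nonneg (convex_Icc a b)
        (fun t ht => (hd t ht).continuousAt.continuousWithinAt)
        (fun t ht => (hd t (interior_subset ht)).differentiableAt.differentiableWithinAt) ?_
      intro t ht
      rw [(hd t (interior_subset ht)).deriv]
      linarith [hkg t (interior_subset ht)]
    intro t ht
    have := hmo ht (right_mem_Icc.2 hab.le) ht.2
    simp only [hub] at this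
    linarith
  set L : ℝ := g b - g a with hL
  have hLpos : 0 < L := by simpa [hL] using hlt
  set s : ℝ → ℝ := fun t => (u t - g a) / L with hs
  have hsd : ∀ t, HasDerivAt s (k t / L) t := fun t => ((hud t).sub_const _).div_const _
  have hsc : Continuous s := continuous_iff_continuousAt.2 fun t => (hsd t).continuousAt
  have hsb : s b = 1 := by simp only [hs, hub]; exact div_self hLpos.ne'
  have hsm : Monotone s := fun x y hxy => by
    simp only [hs]; gcongr; exact hum hxy
  have hsa : ∀ t ≤ a, s t ≤ 0 := fun t ht =>
    div_nonpos_of_nonpos_of_nonneg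
      (by linarith [hum ht, hug a (left_mem_Icc.2 hab.le)]) hLpos.le
  refine ⟨fun t => g a + L * (max (s t) 0 ^ 2 * (2 - s t)),
    fun t => L * (2 * max (s t) 0 * (k t / L) * (2 - s t) + max (s t) 0 ^ 2 * (-(k t / L))),
    ?_, ?_, ?_, ?_, ?_, ?_, ?_⟩
  · intro t _
    exact (((((hasDerivAt_max_zero_sq (s t)).comp t (hsd t)).mul
      ((hsd t).const_sub 2)).const_mul L).const_add (g a))
  · exact Continuous.continuousOn (by fun_prop)
  · simp only [hsb]; norm_num; simp [hL]
  · simp only [hsb, hkb]; norm_num; field_simp; norm_num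
  · intro x hx y hy hxy
    have h1 : max (s x) 0 ≤ max (s y) 0 := max_le_max_right _ (hsm hxy)
    have h2 : s y ≤ 1 := hsb ▸ hsm hy
    have key : max (s x) 0 ^ 2 * (2 - s x) ≤ max (s y) 0 ^ 2 * (2 - s y) := by
      rcases le_total (s x) 0 with h | h
      · rw [max_eq_right h]
        have : 0 ≤ max (s y) 0 ^ 2 * (2 - s y) := mul_nonneg (sq_nonneg _) (by linarith)
        simpa using this
      · have h3 := hsm hxy
        rw [max_eq_left h, max_eq_left (h.trans h3)]
        nlinarith [mul_nonneg (sub_nonneg.2 h3) (mul_nonneg h (sub_nonneg.2 h2)),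
          mul_nonneg (sub_nonneg.2 h3) (mul_nonneg (h.trans h3) (sub_nonneg.2 h2)),
          mul_nonneg (sub_nonneg.2 h3) (mul_nonneg h (sub_nonneg.2 (h3.trans h2))),
          mul_nonneg (sub_nonneg.2 h3) h, mul_nonneg (sub_nonneg.2 h3) (h.trans h3)]
    have := mul_le_mul_of_nonneg_left key hLpos.le
    simpa using this
  · intro t ht
    simp [max_eq_right (hsa t ht)]
  · intro t ht
    rcases le_total (s t) 0 with h | h
    · simpa [max_eq_right h] using hmin t ht
    · have e : g a + L * s t = u t := by simp only [hs]; field_simp; ring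
      have h1 : max (s t) 0 ^ 2 * (2 - s t) ≤ s t := by
        rw [max_eq_left h]; nlinarith [mul_nonneg h (sq_nonneg (1 - s t))]
      have := mul_le_mul_of_nonneg_left h1 hLpos.le
      have := hug t ht
      simp only
      linarith

/-- The quotient `f t / t ^ β` attains its minimum over `(0, σ]`. -/
lemma exists_isLeast_div_rpow {β σ : ℝ} (hβ : 0 < β) (hσ : 0 < σ) {f : ℝ → ℝ}
    (hf : ContinuousOn f (Ici 0)) (hfpos : ∀ t ∈ Ici (0 : ℝ), 0 < f t)
    (hfmono : MonotoneOn f (Ici 0)) :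
    ∃ a ∈ Ioc (0 : ℝ) σ, ∀ t ∈ Ioc (0 : ℝ) σ, f a / a ^ β ≤ f t / t ^ β := by
  have h0 : 0 < f 0 := hfpos 0 self_mem_Ici
  set M : ℝ := f σ / σ ^ β with hM
  have hMpos : 0 < M := div_pos (hfpos σ hσ.le) (rpow_pos_of_pos hσ β)
  set δ : ℝ := (f 0 / M) ^ β⁻¹ with hδ
  have hδpos : 0 < δ := rpow_pos_of_pos (div_pos h0 hMpos) _
  have hδβ : δ ^ β = f 0 / M := rpow_inv_rpow (div_pos h0 hMpos).le hβ.ne'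
  have hsmall : ∀ t, 0 < t → t ≤ δ → M ≤ f t / t ^ β := by
    intro t ht htδ
    have h1 : t ^ β ≤ f 0 / M := hδβ ▸ rpow_le_rpow ht.le htδ hβ.le
    rw [le_div_iff₀ (rpow_pos_of_pos ht β)]
    rw [le_div_iff₀ hMpos] at h1
    linarith [hfmono self_mem_Ici ht.le ht.le]
  have hδσ : δ ≤ σ := by
    rw [← rpow_le_rpow_iff hδpos.le hσ.le hβ, hδβ, div_le_iff₀ hMpos, hM,
      mul_div_cancel₀ _ (rpow_pos_of_pos hσ β).ne']
    exact hfmono self_mem_Ici hσ.le hσ.le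
  have hc : ContinuousOn (fun t => f t / t ^ β) (Icc δ σ) :=
    (hf.mono fun t ht => hδpos.le.trans ht.1).div
      (continuousOn_id.rpow_const fun t _ => Or.inr hβ.le)
      fun t ht => (rpow_pos_of_pos (hδpos.trans_le ht.1) β).ne'
  obtain ⟨a, ha, hmin⟩ := isCompact_Icc.exists_isMinOn (nonempty_Icc.2 hδσ) hc
  refine ⟨a, ⟨hδpos.trans_le ha.1, ha.2⟩, fun t ht => ?_⟩
  rcases le_total δ t with h | h
  · exact hmin ⟨h, ht.2⟩
  · exact (hmin (right_mem_Icc.2 hδσ)).trans (hsmall t ht.1 h)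

/-- Existence of the cut-off nonlinearity `h`: the infimum of `f(t)/t^β`
over `(0, σ₁]` is attained at some `σ⋆ ∈ (0, σ₁]`, and there is a positive `C¹`
function `h` equal to the constant `f(σ⋆)/σ⋆^β` on `[0, σ⋆]`, equal to `f(t)/t^β` for
`t ≥ σ₁`, non-decreasing on `(0, σ₂)`, and pointwise below `f(t)/t^β` on `(0, ∞)`. -/
theorem stmt6 {β σ₁ σ₂ : ℝ} (hβ : β ∈ Set.Ioo (0 : ℝ) 1) (hσ₁ : 0 < σ₁) (hσ₁₂ : σ₁ < σ₂)
    (f : ℝ → ℝ) (hfC1 : ContDiffOn ℝ 1 f (Set.Ici 0))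
    (hfpos : ∀ t ∈ Set.Ici (0 : ℝ), 0 < f t) (hfmono : MonotoneOn f (Set.Ici 0))
    (hquot : MonotoneOn (fun t => f t / t ^ β) (Set.Ioo σ₁ σ₂)) :
    ∃ σs ∈ Set.Ioc (0 : ℝ) σ₁,
      IsLeast ((fun t => f t / t ^ β) '' Set.Ioc (0 : ℝ) σ₁) (f σs / σs ^ β) ∧
      ∃ h : ℝ → ℝ,
        ContDiffOn ℝ 1 h (Set.Ici 0) ∧
        (∀ t ∈ Set.Ici (0 : ℝ), 0 < h t) ∧
        (∀ t, 0 ≤ t → t ≤ σs → h t = f σs / σs ^ β) ∧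
        (∀ t, σ₁ ≤ t → h t = f t / t ^ β) ∧
        MonotoneOn h (Set.Ioo (0 : ℝ) σ₂) ∧
        (∀ t, 0 < t → h t ≤ f t / t ^ β) := by
  obtain ⟨hβ0, hβ1⟩ := hβ
  set g : ℝ → ℝ := fun t => f t / t ^ β with hgdef
  have hgC : ContDiffOn ℝ 1 g (Set.Ioi 0) :=
    (hfC1.mono Set.Ioi_subset_Ici_self).div
      (contDiffOn_id.rpow_const_of_ne fun t ht => ne_of_gt ht)
      fun t ht => (rpow_pos_of_pos ht β).ne'
  have hgd : ∀ t, 0 < t → HasDerivAt g (deriv g t) t := fun t ht =>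
    ((hgC.differentiableOn one_ne_zero).differentiableAt (Ioi_mem_nhds ht)).hasDerivAt
  have hgd' : ContinuousOn (deriv g) (Set.Ioi 0) :=
    hgC.continuousOn_deriv_of_isOpen isOpen_Ioi le_rfl
  have hgpos : ∀ t, 0 < t → 0 < g t := fun t ht =>
    div_pos (hfpos t ht.le) (rpow_pos_of_pos ht β)
  have hgd_nonneg : ∀ t ∈ Set.Ioo σ₁ σ₂, 0 ≤ deriv g t := fun t ht => by
    rw [← derivWithin_of_isOpen isOpen_Ioo ht]
    exact hquot.derivWithin_nonneg
  have hgσ₁ : 0 ≤ deriv g σ₁ := by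
    have h1 : Tendsto (deriv g) (𝓝[>] σ₁) (𝓝 (deriv g σ₁)) :=
      (hgd'.continuousAt (Ioi_mem_nhds hσ₁)).tendsto.mono_left nhdsWithin_le_nhds
    exact ge_of_tendsto h1 (by filter_upwards [Ioo_mem_nhdsGT hσ₁₂] with t ht using hgd_nonneg t ht)
  have hgmono : MonotoneOn g (Set.Ico σ₁ σ₂) := by
    refine monotoneOn_of_deriv_nonneg (convex_Ico σ₁ σ₂)
      (fun t ht => (hgd t (hσ₁.trans_le ht.1)).continuousAt.continuousWithinAt) ?_ ?_
    · intro t ht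
      exact (hgd t (hσ₁.trans_le (interior_subset ht).1)).differentiableAt.differentiableWithinAt
    · rw [interior_Ico]; exact hgd_nonneg
  suffices H : ∃ a ∈ Set.Ioc (0 : ℝ) σ₁, (∀ t ∈ Set.Ioc (0 : ℝ) σ₁, g a ≤ g t) ∧
      ∃ A A' : ℝ → ℝ, (∀ t ≤ σ₁, HasDerivAt A (A' t) t) ∧ ContinuousOn A' (Set.Iic σ₁) ∧
        A σ₁ = g σ₁ ∧ A' σ₁ = deriv g σ₁ ∧ MonotoneOn A (Set.Iic σ₁) ∧
        (∀ t ≤ a, A t = g a) ∧ ∀ t ∈ Set.Icc a σ₁, A t ≤ g t by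
    obtain ⟨a, ha, hmin, A, A', hA, hA', h₀, h₁, hAm, hAa, hAg⟩ := H
    have hle : ∀ t ≤ σ₁, (if t ≤ σ₁ then A t else g t) = A t := fun t ht => if_pos ht
    have hge : ∀ t, σ₁ ≤ t → (if t ≤ σ₁ then A t else g t) = g t := by
      intro t ht
      rcases eq_or_lt_of_le ht with rfl | ht
      · simp [h₀]
      · rw [if_neg (not_le.2 ht)]
    refine ⟨a, ha, ⟨⟨a, ha, rfl⟩, ?_⟩, fun t => if t ≤ σ₁ then A t else g t, ?_, ?_, ?_, hge,
      ?_, ?_⟩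
    · rintro _ ⟨t, ht, rfl⟩
      exact hmin t ht
    · exact (contDiff_one_ite_le hA hA' (fun t ht => hgd t (hσ₁.trans_le ht))
        (hgd'.mono fun t ht => hσ₁.trans_le ht) h₀ h₁).contDiffOn
    · intro t _
      rcases le_total t σ₁ with h | h
      · simp only [hle t h]
        calc 0 < g a := hgpos a ha.1
          _ = A (min t a) := (hAa _ (min_le_right _ _)).symm
          _ ≤ A t := hAm ((min_le_left t a).trans h) h (min_le_left _ _)
      · simp only [hge t h]
        exact hgpos t (hσ₁.trans_le h)
    · intro t _ ht
      simp only [hle t (ht.trans ha.2)]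
      exact hAa t ht
    · rw [← Set.Ioc_union_Ico_eq_Ioo hσ₁ hσ₁₂]
      refine MonotoneOn.union_right (c := σ₁) ?_ ?_ (isGreatest_Ioc hσ₁) (isLeast_Ico hσ₁₂)
      · intro x hx y hy hxy
        simp only [hle x hx.2, hle y hy.2]
        exact hAm hx.2 hy.2 hxy
      · intro x hx y hy hxy
        simp only [hge x hx.1, hge y hy.1]
        exact hgmono hx hy hxy
    · intro t ht
      rcases le_total t σ₁ with h | h
      · simp only [hle t h]
        rcases le_total t a with h' | h'
        · rw [hAa t h']; exact hmin t ⟨ht, h⟩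
        · exact hAg t ⟨h', h⟩
      · exact (hge t h).le
  obtain ⟨a, ha, hmin⟩ := exists_isLeast_div_rpow hβ0 hσ₁ hfC1.continuousOn hfpos hfmono
  change ∀ t ∈ Set.Ioc (0 : ℝ) σ₁, g a ≤ g t at hmin
  rcases (hmin σ₁ ⟨hσ₁, le_rfl⟩).eq_or_lt with h | h
  · have hmin' : ∀ t ∈ Set.Ioc (0 : ℝ) σ₁, g σ₁ ≤ g t := fun t ht => h ▸ hmin t ht
    have hloc : IsLocalMin g σ₁ := by
      filter_upwards [Ioo_mem_nhds hσ₁ hσ₁₂] with t ht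
      rcases le_total t σ₁ with h | h
      · exact hmin' t ⟨ht.1, h⟩
      · exact hgmono (Set.left_mem_Ico.2 hσ₁₂) ⟨h, ht.2⟩ h
    exact ⟨σ₁, ⟨hσ₁, le_rfl⟩, hmin', fun _ => g σ₁, fun _ => 0, fun t _ => hasDerivAt_const _ _,
      continuousOn_const, rfl, hloc.deriv_eq_zero.symm, fun _ _ _ _ _ => le_rfl, fun _ _ => rfl,
      fun t ht => hmin' t ⟨hσ₁.trans_le ht.1, ht.2⟩⟩
  · have haσ : a < σ₁ := lt_of_le_of_ne ha.2 (by rintro rfl; exact lt_irrefl _ h)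
    exact ⟨a, ha, hmin, exists_monotone_minorant haσ (fun t ht => hgd t (ha.1.trans_le ht.1))
      (hgd'.mono fun t ht => ha.1.trans_le ht.1) (fun t ht => hmin t ⟨ha.1.trans_le ht.1, ht.2⟩)
      h hgσ₁⟩
end

section
/- Let N ≥ 1 and α ∈ (0,1). Write points of ℝ^N as y = (y′, y_N) with y′ ∈ ℝ^{N−1}, let B₁ be the open unit ball of ℝ^N centered at 0, and B₁⁺ := { y ∈ B₁ : y_N > 0 }. Let q : ℝ^N → ℝ be continuous on the closure of B₁⁺, with q(y′, 0) = 0 whenever (y′, 0) ∈ B₁, and suppose there is a map F : closure(B₁⁺) → ℝ^N that is α-Hölder continuous on closure(B₁⁺) such that at every point z ∈ closure(B₁⁺) ∩ B₁ the function q is differentiable within closure(B₁⁺) with derivative h ↦ F(z)·h. Define the odd reflection q̃ : B₁ → ℝ by q̃(y′, y_N) = q(y′, y_N) if y_N ≥ 0 and q̃(y′, y_N) = − q(y′, −y_N) if y_N < 0. Then q̃ is differentiable at every point of B₁ and its gradient is α-Hölder continuous on B₁; that is, q̃ ∈ C^{1,α}(B₁). -/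
open Real Metric

/-- Reflection of `y ∈ ℝ^N` in the hyperplane `{y_i = 0}`: it negates the `i`-th
coordinate and keeps the others. -/
noncomputable def reflCoord {N : ℕ} (i : Fin N) (y : EuclideanSpace ℝ (Fin N)) :
    EuclideanSpace ℝ (Fin N) :=
  y - (2 * y i) • EuclideanSpace.single i (1 : ℝ)

/-- The open upper half ball `B₁⁺ = {y ∈ B₁ : y_i > 0}` of the unit ball of `ℝ^N`,
the `i`-th coordinate playing the role of the last coordinate `y_N`. -/
def upperHalfBall {N : ℕ} (i : Fin N) : Set (EuclideanSpace ℝ (Fin N)) :=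
  {y ∈ Metric.ball (0 : EuclideanSpace ℝ (Fin N)) 1 | 0 < y i}

namespace OddReflection

variable {N : ℕ} (i : Fin N)

local notation "E" => EuclideanSpace ℝ (Fin N)

theorem reflCoord_apply (y : E) (j : Fin N) :
    reflCoord i y j = if j = i then -y j else y j := by
  by_cases h : j = i
  · subst h
    simp [reflCoord]
    ring
  · simp [reflCoord, h]

theorem reflCoord_apply_self (y : E) : reflCoord i y i = -y i := by
  simp [reflCoord_apply]

theorem reflCoord_reflCoord (y : E) : reflCoord i (reflCoord i y) = y := by
  ext j
  by_cases h : j = i <;> simp [reflCoord_apply, h]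

theorem reflCoord_of_apply_eq_zero {y : E} (hy : y i = 0) : reflCoord i y = y := by
  simp [reflCoord, hy]

/-- The reflection `reflCoord i` as a linear isometry. -/
noncomputable def reflIsometry : E →ₗᵢ[ℝ] E where
  toFun := reflCoord i
  map_add' x y := by
    ext j
    by_cases h : j = i <;> simp [reflCoord_apply, h]
    ring
  map_smul' c x := by
    ext j
    by_cases h : j = i <;> simp [reflCoord_apply, h]
  norm_map' x := by
    change ‖reflCoord i x‖ = ‖x‖
    simp only [EuclideanSpace.norm_eq, reflCoord_apply]
    congr 1
    refine Finset.sum_congr rfl fun j _ => ?_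
    split_ifs <;> simp

theorem reflIsometry_apply (y : E) : reflIsometry i y = reflCoord i y := rfl

theorem norm_reflCoord (y : E) : ‖reflCoord i y‖ = ‖y‖ := (reflIsometry i).norm_map y

theorem norm_reflCoord_sub (x y : E) : ‖reflCoord i x - reflCoord i y‖ = ‖x - y‖ := by
  simp only [← reflIsometry_apply, ← map_sub, LinearIsometry.norm_map]

theorem inner_reflCoord_left (x y : E) :
    inner ℝ (reflCoord i x) y = inner ℝ x (reflCoord i y) := by
  have h := (reflIsometry i).inner_map_map x (reflCoord i y)
  rwa [reflIsometry_apply, reflIsometry_apply, reflCoord_reflCoord] at h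

theorem reflCoord_mem_ball {y : E} (hy : y ∈ ball (0 : E) 1) :
    reflCoord i y ∈ ball (0 : E) 1 := by
  rw [mem_ball_zero_iff] at hy ⊢
  rwa [norm_reflCoord]

theorem mem_closure_upperHalfBall {z : E} (hz : z ∈ ball (0 : E) 1) (hzi : 0 ≤ z i) :
    z ∈ closure (upperHalfBall i) := by
  have hlim : Filter.Tendsto (fun t : ℝ => z + t • EuclideanSpace.single i (1 : ℝ))
      (nhdsWithin 0 (Set.Ioi 0)) (nhds z) := by
    have hc : Continuous fun t : ℝ => z + t • EuclideanSpace.single i (1 : ℝ) := by fun_prop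
    simpa using (hc.tendsto 0).mono_left nhdsWithin_le_nhds
  refine mem_closure_of_tendsto hlim ?_
  filter_upwards [hlim.eventually (isOpen_ball.mem_nhds hz), self_mem_nhdsWithin] with t ht ht0
  refine ⟨ht, ?_⟩
  have ht0 : 0 < t := ht0
  simp
  linarith

/-- A gradient representing the derivative of a function within the closed half ball which
vanishes on the flat part of the boundary is normal to it, hence is negated by the reflection. -/
theorem reflCoord_eq_neg_of_vanishing {q : E → ℝ} {v z : E}
    (hq0 : ∀ y ∈ ball (0 : E) 1, y i = 0 → q y = 0)
    (hz : z ∈ ball (0 : E) 1) (hzi : z i = 0)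
    (hd : HasFDerivWithinAt q (innerSL ℝ v) (closure (upperHalfBall i)) z) :
    reflCoord i v = -v := by
  have htan : ∀ w : E, w i = 0 → inner ℝ v w = 0 := by
    intro w hw
    have hc : Continuous fun t : ℝ => z + t • w := by fun_prop
    have hmem : ∀ᶠ t : ℝ in nhds 0, z + t • w ∈ ball (0 : E) 1 :=
      hc.continuousAt.eventually_mem (isOpen_ball.mem_nhds (by simpa using hz))
    have hpi : ∀ t : ℝ, (z + t • w) i = 0 := by simp [hzi, hw]
    have hline : HasDerivAt (fun t : ℝ => z + t • w) w 0 := by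
      simpa using ((hasDerivAt_id (0 : ℝ)).smul_const w).const_add z
    set s : Set ℝ := {t | z + t • w ∈ ball (0 : E) 1} with hs
    have hcomp : HasDerivWithinAt (fun t : ℝ => q (z + t • w)) (innerSL ℝ v w) s 0 := by
      refine HasFDerivWithinAt.comp_hasDerivWithinAt (t := closure (upperHalfBall i))
        (0 : ℝ) (by simpa using hd) hline.hasDerivWithinAt ?_
      exact fun t ht => mem_closure_upperHalfBall i ht (hpi t).ge
    have h1 := hcomp.hasDerivAt hmem
    have h0 : HasDerivAt (fun t : ℝ => q (z + t • w)) 0 0 :=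
      (hasDerivAt_const (0 : ℝ) (0 : ℝ)).congr_of_eventuallyEq
        (hmem.mono fun t ht => hq0 _ ht (hpi t))
    simpa using h1.unique h0
  have hsum : (reflCoord i v + v) i = 0 := by simp [reflCoord_apply]
  have h := htan _ hsum
  have h' : inner ℝ (reflCoord i v) (reflCoord i v + v) = 0 := by
    rw [inner_reflCoord_left, reflCoord_of_apply_eq_zero i hsum, h]
  have hnorm : inner ℝ (reflCoord i v + v) (reflCoord i v + v) = 0 := by
    rw [inner_add_left, h, h', add_zero]
  exact eq_neg_of_add_eq_zero_left (inner_self_eq_zero.mp hnorm)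

theorem hasFDerivWithinAt_halfSpace {q : E → ℝ} {q' : E →L[ℝ] ℝ} {z : E}
    (hz : z ∈ ball (0 : E) 1)
    (hd : HasFDerivWithinAt q q' (closure (upperHalfBall i)) z) :
    HasFDerivWithinAt q q' {y : E | 0 ≤ y i} z := by
  refine hd.mono_of_mem_nhdsWithin ?_
  filter_upwards [self_mem_nhdsWithin, mem_nhdsWithin_of_mem_nhds (isOpen_ball.mem_nhds hz)]
    with y hy hyb using mem_closure_upperHalfBall i hyb hy

/-- If two maps, Hölder on the two closed halves of the unit ball respectively, glue to `G`,
then `G` is Hölder on the whole ball. -/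
theorem holder_of_holder_halves {G : E → E} {L α : ℝ} (hL : 0 ≤ L) (hα : 0 ≤ α)
    (hpos : ∀ x ∈ ball (0 : E) 1, ∀ y ∈ ball (0 : E) 1, 0 ≤ x i → 0 ≤ y i →
      ‖G x - G y‖ ≤ L * ‖x - y‖ ^ α)
    (hneg : ∀ x ∈ ball (0 : E) 1, ∀ y ∈ ball (0 : E) 1, x i ≤ 0 → y i ≤ 0 →
      ‖G x - G y‖ ≤ L * ‖x - y‖ ^ α)
    {x y : E} (hx : x ∈ ball (0 : E) 1) (hy : y ∈ ball (0 : E) 1) :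
    ‖G x - G y‖ ≤ 2 * L * ‖x - y‖ ^ α := by
  have hmixed : ∀ x ∈ ball (0 : E) 1, ∀ y ∈ ball (0 : E) 1, 0 ≤ x i → y i < 0 →
      ‖G x - G y‖ ≤ 2 * L * ‖x - y‖ ^ α := by
    intro x hx y hy hxi hyi
    have hpos' : 0 < x i - y i := by linarith
    set t : ℝ := x i / (x i - y i) with ht
    have ht0 : 0 ≤ t := by positivity
    have ht1 : t ≤ 1 := by rw [ht, div_le_one hpos']; linarith
    set p : E := x + t • (y - x) with hp
    have hpb : p ∈ ball (0 : E) 1 :=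
      (convex_ball (0 : E) 1).add_smul_sub_mem hx hy ⟨ht0, ht1⟩
    have hpi : p i = 0 := by
      simp only [hp, ht, PiLp.add_apply, PiLp.smul_apply, PiLp.sub_apply, smul_eq_mul]
      field_simp
      ring
    have hxp : ‖x - p‖ ≤ ‖x - y‖ := by
      have : x - p = t • (x - y) := by rw [hp]; module
      rw [this, norm_smul, Real.norm_of_nonneg ht0]
      exact mul_le_of_le_one_left (norm_nonneg _) ht1
    have hpy : ‖p - y‖ ≤ ‖x - y‖ := by
      have : p - y = (1 - t) • (x - y) := by rw [hp]; module
      rw [this, norm_smul, Real.norm_of_nonneg (by linarith)]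
      exact mul_le_of_le_one_left (norm_nonneg _) (by linarith)
    calc ‖G x - G y‖ ≤ ‖G x - G p‖ + ‖G p - G y‖ := norm_sub_le_norm_sub_add_norm_sub _ _ _
      _ ≤ L * ‖x - p‖ ^ α + L * ‖p - y‖ ^ α :=
        add_le_add (hpos x hx p hpb hxi hpi.ge) (hneg p hpb y hy hpi.le hyi.le)
      _ ≤ L * ‖x - y‖ ^ α + L * ‖x - y‖ ^ α := by gcongr
      _ = 2 * L * ‖x - y‖ ^ α := by ring
  have hdouble : L * ‖x - y‖ ^ α ≤ 2 * L * ‖x - y‖ ^ α := by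
    have : 0 ≤ L * ‖x - y‖ ^ α := by positivity
    linarith
  rcases le_or_gt 0 (x i) with hxi | hxi <;> rcases le_or_gt 0 (y i) with hyi | hyi
  · exact (hpos x hx y hy hxi hyi).trans hdouble
  · exact hmixed x hx y hy hxi hyi
  · rw [norm_sub_rev (G x), norm_sub_rev x]
    exact hmixed y hy x hx hyi hxi
  · exact (hneg x hx y hy hxi.le hyi.le).trans hdouble

end OddReflection

open OddReflection

/-- Odd reflection preserves `C^{1,α}` regularity: if `q` is continuous on
`closure B₁⁺`, vanishes on `{y_N = 0} ∩ B₁`, and is differentiable within `closure B₁⁺`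
with an `α`-Hölder continuous gradient `F`, then its odd reflection `q̃` is differentiable
at every point of `B₁` with `α`-Hölder continuous gradient on `B₁`. -/
theorem stmt9 {N : ℕ} (hN : 1 ≤ N) {α : ℝ} (hα : α ∈ Set.Ioo (0 : ℝ) 1)
    (i : Fin N) (hi : (i : ℕ) = N - 1)
    (q : EuclideanSpace ℝ (Fin N) → ℝ)
    (F : EuclideanSpace ℝ (Fin N) → EuclideanSpace ℝ (Fin N))
    (hqc : ContinuousOn q (closure (upperHalfBall i)))
    (hq0 : ∀ y ∈ Metric.ball (0 : EuclideanSpace ℝ (Fin N)) 1, y i = 0 → q y = 0)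
    (hFholder : ∃ L : ℝ, ∀ z₁ ∈ closure (upperHalfBall i), ∀ z₂ ∈ closure (upperHalfBall i),
      ‖F z₁ - F z₂‖ ≤ L * ‖z₁ - z₂‖ ^ α)
    (hdiff : ∀ z ∈ closure (upperHalfBall i) ∩ Metric.ball (0 : EuclideanSpace ℝ (Fin N)) 1,
      HasFDerivWithinAt q (innerSL ℝ (F z)) (closure (upperHalfBall i)) z)
    (qt : EuclideanSpace ℝ (Fin N) → ℝ)
    (hqt₁ : ∀ y : EuclideanSpace ℝ (Fin N), 0 ≤ y i → qt y = q y)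
    (hqt₂ : ∀ y : EuclideanSpace ℝ (Fin N), y i < 0 → qt y = -q (reflCoord i y)) :
    (∀ z ∈ Metric.ball (0 : EuclideanSpace ℝ (Fin N)) 1, DifferentiableAt ℝ qt z) ∧
    ∃ L : ℝ, ∀ z₁ ∈ Metric.ball (0 : EuclideanSpace ℝ (Fin N)) 1,
      ∀ z₂ ∈ Metric.ball (0 : EuclideanSpace ℝ (Fin N)) 1,
        ‖gradient qt z₁ - gradient qt z₂‖ ≤ L * ‖z₁ - z₂‖ ^ α := by
  have hgrad_pos : ∀ z ∈ ball (0 : EuclideanSpace ℝ (Fin N)) 1, 0 ≤ z i →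
      HasFDerivWithinAt qt (innerSL ℝ (F z)) {y | 0 ≤ y i} z := by
    intro z hz hzi
    refine (hasFDerivWithinAt_halfSpace i hz
      (hdiff z ⟨mem_closure_upperHalfBall i hz hzi, hz⟩)).congr (fun y hy => hqt₁ y hy) ?_
    exact hqt₁ z hzi
  have hqt_neg : ∀ y ∈ ball (0 : EuclideanSpace ℝ (Fin N)) 1, y i ≤ 0 →
      qt y = -q (reflCoord i y) := by
    intro y hy hyi
    rcases hyi.lt_or_eq with h | h
    · exact hqt₂ y h
    · rw [hqt₁ y h.ge, reflCoord_of_apply_eq_zero i h, hq0 y hy h, neg_zero]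
  have hgrad_neg : ∀ z ∈ ball (0 : EuclideanSpace ℝ (Fin N)) 1, z i ≤ 0 →
      HasFDerivWithinAt qt (innerSL ℝ (-reflCoord i (F (reflCoord i z)))) {y | y i ≤ 0} z := by
    intro z hz hzi
    have hRz := reflCoord_mem_ball i hz
    have hRzi : 0 ≤ reflCoord i z i := by rw [reflCoord_apply_self]; linarith
    have hq := hasFDerivWithinAt_halfSpace i hRz
      (hdiff _ ⟨mem_closure_upperHalfBall i hRz hRzi, hRz⟩)
    have hR : HasFDerivWithinAt (reflCoord i) (reflIsometry i).toContinuousLinearMap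
        {y | y i ≤ 0} z := (reflIsometry i).toContinuousLinearMap.hasFDerivWithinAt
    have hmaps : Set.MapsTo (reflCoord i) {y | y i ≤ 0} {y | 0 ≤ y i} := by
      intro y hy
      have hy : y i ≤ 0 := hy
      change 0 ≤ reflCoord i y i
      rw [reflCoord_apply_self]
      linarith
    have hcomp := (hq.comp z hR hmaps).neg
    have hL : innerSL ℝ (-reflCoord i (F (reflCoord i z))) =
        -((innerSL ℝ (F (reflCoord i z))).comp (reflIsometry i).toContinuousLinearMap) := by
      ext w
      simp [inner_reflCoord_left, reflIsometry_apply]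
    rw [hL]
    refine hcomp.congr_of_eventuallyEq ?_ (hqt_neg z hz hzi)
    filter_upwards [self_mem_nhdsWithin, mem_nhdsWithin_of_mem_nhds (isOpen_ball.mem_nhds hz)]
      with y hy hyb using hqt_neg y hyb hy
  set G : EuclideanSpace ℝ (Fin N) → EuclideanSpace ℝ (Fin N) :=
    fun z => if 0 ≤ z i then F z else -reflCoord i (F (reflCoord i z)) with hG
  have hG_pos : ∀ z, 0 ≤ z i → G z = F z := fun z hz => if_pos hz
  have hG_neg : ∀ z ∈ ball (0 : EuclideanSpace ℝ (Fin N)) 1, z i ≤ 0 →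
      G z = -reflCoord i (F (reflCoord i z)) := by
    intro z hz hzi
    rcases hzi.lt_or_eq with h | h
    · exact if_neg h.not_ge
    · rw [hG_pos z h.ge, reflCoord_of_apply_eq_zero i h, reflCoord_eq_neg_of_vanishing i hq0 hz h
        (hdiff z ⟨mem_closure_upperHalfBall i hz h.ge, hz⟩), neg_neg]
  have hgrad : ∀ z ∈ ball (0 : EuclideanSpace ℝ (Fin N)) 1, HasGradientAt qt (G z) z := by
    intro z hz
    have hci : Continuous fun y : EuclideanSpace ℝ (Fin N) => y i := by fun_prop
    change HasFDerivAt qt (innerSL ℝ (G z)) z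
    rcases lt_trichotomy (z i) 0 with h | h | h
    · rw [hG_neg z hz h.le]
      exact (hgrad_neg z hz h.le).hasFDerivAt
        ((hci.continuousAt.eventually_lt_const h).mono fun y hy => hy.le)
    · have hpos := hgrad_pos z hz h.ge
      have hneg := hgrad_neg z hz h.le
      rw [← hG_pos z h.ge] at hpos
      rw [← hG_neg z hz h.le] at hneg
      refine (hpos.union hneg).hasFDerivAt (Filter.univ_mem' fun y => ?_)
      exact le_total 0 (y i)
    · rw [hG_pos z h.le]
      exact (hgrad_pos z hz h.le).hasFDerivAt
        ((hci.continuousAt.eventually_const_lt h).mono fun y hy => hy.le)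
  refine ⟨fun z hz => (hgrad z hz).differentiableAt, ?_⟩
  obtain ⟨L, hL⟩ := hFholder
  have hF : ∀ x ∈ ball (0 : EuclideanSpace ℝ (Fin N)) 1,
      ∀ y ∈ ball (0 : EuclideanSpace ℝ (Fin N)) 1, 0 ≤ x i → 0 ≤ y i →
      ‖F x - F y‖ ≤ max L 0 * ‖x - y‖ ^ α := by
    intro x hx y hy hxi hyi
    refine (hL x (mem_closure_upperHalfBall i hx hxi) y
      (mem_closure_upperHalfBall i hy hyi)).trans ?_
    gcongr
    exact le_max_left _ _
  refine ⟨2 * max L 0, fun x hx y hy => ?_⟩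
  rw [(hgrad x hx).gradient, (hgrad y hy).gradient]
  refine holder_of_holder_halves i (le_max_right _ _) hα.1.le ?_ ?_ hx hy
  · intro x hx y hy hxi hyi
    rw [hG_pos x hxi, hG_pos y hyi]
    exact hF x hx y hy hxi hyi
  · intro x hx y hy hxi hyi
    rw [hG_neg x hx hxi, hG_neg y hy hyi, neg_sub_neg, norm_sub_rev, norm_reflCoord_sub,
      ← norm_reflCoord_sub i x y]
    refine hF _ (reflCoord_mem_ball i hx) _ (reflCoord_mem_ball i hy) ?_ ?_ <;>
      rw [reflCoord_apply_self] <;> linarith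
end

section
/- Let 0 < β < 1, let γ ∈ (1, 2−β), and let c₂, δ, k > 0. Then there exist η > 0 and k₁ > 0 such that for every t ∈ (0, η), 1 + γ (c₂ t)^{γ−1} − γ(γ−1) (c₂ t)^{γ−2} δ² + (k / t^{β+1}) ( c₂ t + (c₂ t)^γ ) ≤ − k₁ t^{γ−2}. -/
open Real

open Filter Topology in
/-- A positive real power tends to `0` at `0` from the right. -/
theorem tendsto_rpow_nhdsGT_zero {p : ℝ} (hp : 0 < p) :
    Tendsto (fun t : ℝ => t ^ p) (𝓝[>] 0) (𝓝 0) := by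
  have h := (continuousAt_rpow_const 0 p (Or.inr hp.le)).tendsto
  rw [zero_rpow hp.ne'] at h
  exact h.mono_left nhdsWithin_le_nhds

/-- The left-hand side of the boundary estimate with the dominant power `t ^ (γ - 2)`
factored out. -/
theorem boundary_expr_eq_rpow_mul {c t : ℝ} (β γ δ k : ℝ) (hc : 0 ≤ c) (ht : 0 < t) :
    1 + γ * (c * t) ^ (γ - 1) - γ * (γ - 1) * (c * t) ^ (γ - 2) * δ ^ 2
        + k / t ^ (β + 1) * (c * t + (c * t) ^ γ) =
      t ^ (γ - 2) * (t ^ (2 - γ) + γ * c ^ (γ - 1) * t + k * c * t ^ (2 - β - γ)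
        + k * c ^ γ * t ^ (1 - β) - γ * (γ - 1) * c ^ (γ - 2) * δ ^ 2) := by
  have h₁ : t ^ (γ - 2) * t ^ (2 - γ) = 1 := by
    rw [← rpow_add ht, show γ - 2 + (2 - γ) = 0 by ring, rpow_zero]
  have h₂ : t ^ (γ - 2) * t = t ^ (γ - 1) := by
    rw [← rpow_add_one ht.ne']
    ring_nf
  have h₃ : t ^ (γ - 2) * t ^ (2 - β - γ) = t / t ^ (β + 1) := by
    nth_rw 3 [← rpow_one t]
    rw [← rpow_add ht, ← rpow_sub ht]
    ring_nf
  have h₄ : t ^ (γ - 2) * t ^ (1 - β) = t ^ γ / t ^ (β + 1) := by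
    rw [← rpow_add ht, ← rpow_sub ht]
    ring_nf
  simp only [mul_rpow hc ht.le]
  linear_combination -h₁ - γ * c ^ (γ - 1) * h₂ - k * c * h₃ - k * c ^ γ * h₄

/-- Key boundary asymptotic estimate in the Hopf-type strong comparison
principle: for `0 < β < 1`, `1 < γ < 2 − β` and positive constants `c₂, δ, k`, near `t = 0`
the quantity `1 + γ(c₂t)^{γ−1} − γ(γ−1)(c₂t)^{γ−2}δ² + (k/t^{β+1})(c₂t + (c₂t)^γ)` is
bounded above by `−k₁ t^{γ−2}`. -/
theorem stmt11 {β γ c₂ δ k : ℝ} (hβ0 : 0 < β) (hβ1 : β < 1)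
    (hγ1 : 1 < γ) (hγ2 : γ < 2 - β) (hc₂ : 0 < c₂) (hδ : 0 < δ) (hk : 0 < k) :
    ∃ η > (0 : ℝ), ∃ k₁ > (0 : ℝ), ∀ t ∈ Set.Ioo (0 : ℝ) η,
      1 + γ * (c₂ * t) ^ (γ - 1) - γ * (γ - 1) * (c₂ * t) ^ (γ - 2) * δ ^ 2
          + k / t ^ (β + 1) * (c₂ * t + (c₂ * t) ^ γ) ≤ -k₁ * t ^ (γ - 2) := by
  set A := γ * (γ - 1) * c₂ ^ (γ - 2) * δ ^ 2 with hA_def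
  have hA : 0 < A := by
    have : 0 < γ - 1 := sub_pos.2 hγ1
    positivity
  have hlim : Filter.Tendsto (fun t : ℝ => t ^ (2 - γ) + γ * c₂ ^ (γ - 1) * t
      + k * c₂ * t ^ (2 - β - γ) + k * c₂ ^ γ * t ^ (1 - β)) (nhdsWithin 0 (Set.Ioi 0))
      (nhds 0) := by
    have hid : Filter.Tendsto (fun t : ℝ => t) (nhdsWithin 0 (Set.Ioi 0)) (nhds 0) :=
      nhdsWithin_le_nhds
    simpa using (((tendsto_rpow_nhdsGT_zero (p := 2 - γ) (by linarith)).add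
      (hid.const_mul (γ * c₂ ^ (γ - 1)))).add
      ((tendsto_rpow_nhdsGT_zero (p := 2 - β - γ) (by linarith)).const_mul (k * c₂))).add
      ((tendsto_rpow_nhdsGT_zero (p := 1 - β) (by linarith)).const_mul (k * c₂ ^ γ))
  obtain ⟨η, hη, hsub⟩ := mem_nhdsGT_iff_exists_Ioo_subset.1
    (hlim.eventually_lt_const (half_pos hA))
  refine ⟨η, hη, A / 2, half_pos hA, fun t ht => ?_⟩
  have hlt := hsub ht
  rw [Set.mem_ofPred_eq] at hlt
  rw [boundary_expr_eq_rpow_mul β γ δ k hc₂.le ht.1, ← hA_def, mul_comm]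
  exact mul_le_mul_of_nonneg_right (by linarith) (rpow_nonneg ht.1.le _)
end
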